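/- arXiv:2210.01408 — 6 statements merged into one kernel-verified Lean document; each statement's English description precedes it below -/
import Mathlib

section
/- Suppose the nonconformity score V is monotone, that for every j ∈ {1,…,m} the random variables (V_1,…,V_n, V_{n+j}) are exchangeable conditional on (V̂_{n+ℓ})_{ℓ≠j}, and that the random variables {V_i}_{i=1}^n ∪ {V̂_{n+ℓ}}_{ℓ=1}^m almost surely have no ties. Then for every q ∈ (0,1), the rejection set ℛ of the Benjamini–Hochberg procedure at level q applied to the deterministic conformal p-values p_j^dtm = (1 + Σ_{i=1}^n 1{V_i < V̂_{n+j}})/(n+1), j = 1,…,m, satisfies FDR ≤ q. -/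
set_option autoImplicit false

open MeasureTheory ProbabilityTheory Finset
open scoped Classical

/-- The Benjamini–Hochberg cutoff index `k* = max{k ∈ {1,…,m} : #{j : a_j ≤ qk/m} ≥ k}`
(`0` if no such `k` exists). -/
noncomputable def bhKstar (q : ℝ) (m : ℕ) (a : Fin m → ℝ) : ℕ :=
  Nat.findGreatest
    (fun k => k ≤ ((Finset.univ : Finset (Fin m)).filter
      (fun j => a j ≤ q * k / m)).card) m

/-- The Benjamini–Hochberg rejection set `ℛ = {j : a_j ≤ q k*/m}` at level `q`. -/
noncomputable def bhReject (q : ℝ) (m : ℕ) (a : Fin m → ℝ) : Finset (Fin m) :=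
  (Finset.univ : Finset (Fin m)).filter
    (fun j => a j ≤ q * (bhKstar q m a) / m)

open MeasureTheory ProbabilityTheory Finset
open scoped Classical

lemma bhK_spec (q : ℝ) (m : ℕ) (a : Fin m → ℝ) :
    bhKstar q m a ≤ ((Finset.univ : Finset (Fin m)).filter
      (fun j => a j ≤ q * (bhKstar q m a : ℕ) / m)).card := by
  have := Nat.findGreatest_spec (P := fun k : ℕ => k ≤ ((Finset.univ : Finset (Fin m)).filter
      (fun j => a j ≤ q * k / m)).card) (Nat.zero_le m) (Nat.zero_le _)
  exact this

lemma bhK_le (q : ℝ) (m : ℕ) (a : Fin m → ℝ) : bhKstar q m a ≤ m :=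
  Nat.findGreatest_le m

lemma le_bhK (q : ℝ) (m : ℕ) (a : Fin m → ℝ) (k : ℕ) (hk : k ≤ m)
    (h : k ≤ ((Finset.univ : Finset (Fin m)).filter (fun j => a j ≤ q * k / m)).card) :
    k ≤ bhKstar q m a :=
  Nat.le_findGreatest (P := fun k : ℕ => k ≤ ((Finset.univ : Finset (Fin m)).filter
      (fun j => a j ≤ q * k / m)).card) hk h

lemma thr_mono (q : ℝ) (hq : 0 < q) (m k k' : ℕ) (h : k ≤ k') :
    q * (k : ℝ) / m ≤ q * (k' : ℝ) / m := by
  gcongr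

lemma bh_card (q : ℝ) (hq : 0 < q) (m : ℕ) (a : Fin m → ℝ) :
    (bhReject q m a).card = bhKstar q m a := by
  apply le_antisymm
  · apply le_bhK
    · simpa using Finset.card_le_univ (bhReject q m a)
    · apply Finset.card_le_card
      intro j hj
      simp only [bhReject, Finset.mem_filter, Finset.mem_univ, true_and] at hj
      refine Finset.mem_filter.2 ⟨Finset.mem_univ _, ?_⟩
      refine hj.trans (thr_mono q hq m _ _ (bhK_spec q m a))
  · exact bhK_spec q m a

lemma bhK_congr (q : ℝ) (hq : 0 < q) (m : ℕ) (a b : Fin m → ℝ) (hle : ∀ l, b l ≤ a l)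
    (h : ∀ l, b l = a l ∨ a l ≤ q * (bhKstar q m a : ℕ) / m) :
    bhKstar q m b = bhKstar q m a := by
  have h1 : bhKstar q m a ≤ bhKstar q m b := by
    apply le_bhK _ _ _ _ (bhK_le _ _ _)
    refine (bhK_spec q m a).trans (Finset.card_le_card ?_)
    intro j hj
    simp only [Finset.mem_filter, Finset.mem_univ, true_and] at hj ⊢
    exact (hle j).trans hj
  apply le_antisymm _ h1
  apply le_bhK _ _ _ _ (bhK_le _ _ _)
  refine (bhK_spec q m b).trans (Finset.card_le_card ?_)
  intro j hj
  simp only [Finset.mem_filter, Finset.mem_univ, true_and] at hj ⊢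
  rcases h j with h | h
  · rwa [← h]
  · exact h.trans (thr_mono q hq m _ _ h1)

/-- modified p-values -/
noncomputable def ptil (n m : ℕ) (j : Fin m)
    (z : (Fin n ⊕ Unit → ℝ) × ({l : Fin m // l ≠ j} → ℝ)) (l : Fin m) : ℝ :=
  if h : l ≠ j then
    (((Finset.univ.filter (fun k => z.1 k < z.2 ⟨l, h⟩)).card : ℕ) : ℝ) / (n + 1)
  else 0

noncomputable def Fb (q : ℝ) (n m : ℕ) (j : Fin m) (k : Fin n ⊕ Unit)
    (z : (Fin n ⊕ Unit → ℝ) × ({l : Fin m // l ≠ j} → ℝ)) : ℝ :=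
  if (((Finset.univ.filter (fun k' => z.1 k' ≤ z.1 k)).card : ℕ) : ℝ) / (n + 1)
      ≤ q * (bhKstar q m (ptil n m j z) : ℕ) / m
  then 1 / (bhKstar q m (ptil n m j z) : ℝ) else 0

lemma card_perm {α : Type*} [Fintype α] (σ : Equiv.Perm α) (P : α → Prop) :
    (Finset.univ.filter (fun k => P (σ k))).card = (Finset.univ.filter P).card := by
  apply Finset.card_bij (fun a _ => σ a)
  · intro a ha; simpa using ha
  · intro a _ b _ h; exact σ.injective h
  · intro b hb; exact ⟨σ.symm b, by simpa using hb, by simp⟩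

lemma ptil_perm (n m : ℕ) (j : Fin m) (w : Fin n ⊕ Unit → ℝ) (u : {l : Fin m // l ≠ j} → ℝ)
    (σ : Equiv.Perm (Fin n ⊕ Unit)) :
    ptil n m j (fun k => w (σ k), u) = ptil n m j (w, u) := by
  funext l
  unfold ptil
  split_ifs with h
  · have := card_perm σ (fun k => w k < u ⟨l, h⟩)
    simp only [this]
  · rfl

lemma Fb_perm (q : ℝ) (n m : ℕ) (j : Fin m) (w : Fin n ⊕ Unit → ℝ)
    (u : {l : Fin m // l ≠ j} → ℝ)
    (σ : Equiv.Perm (Fin n ⊕ Unit)) (k : Fin n ⊕ Unit) :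
    Fb q n m j k (fun k => w (σ k), u) = Fb q n m j (σ k) (w, u) := by
  unfold Fb
  rw [ptil_perm]
  have := card_perm σ (fun k' => w k' ≤ w (σ k))
  simp only [this]

lemma bhK_pos (q : ℝ) (hq : 0 < q) (n m : ℕ) (j : Fin m)
    (z : (Fin n ⊕ Unit → ℝ) × ({l : Fin m // l ≠ j} → ℝ)) :
    1 ≤ bhKstar q m (ptil n m j z) := by
  apply le_bhK
  · exact Nat.succ_le_of_lt (Nat.lt_of_le_of_lt (Nat.zero_le _) j.2)
  · rw [Nat.one_le_iff_ne_zero, Finset.card_ne_zero]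
    refine ⟨j, ?_⟩
    simp [ptil]
    positivity

lemma rank_count {α : Type*} [Fintype α] (w : α → ℝ) (t : ℝ) (ht : 0 ≤ t) :
    ((Finset.univ.filter (fun k =>
      (((Finset.univ.filter (fun k' => w k' ≤ w k)).card : ℕ) : ℝ) ≤ t)).card : ℝ) ≤ t := by
  set S := Finset.univ.filter (fun k =>
      (((Finset.univ.filter (fun k' => w k' ≤ w k)).card : ℕ) : ℝ) ≤ t) with hS
  rcases S.eq_empty_or_nonempty with h | h
  · rw [h]; simpa using ht
  · obtain ⟨k, hk, hmax⟩ := Finset.exists_max_image S w h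
    have hk' := (Finset.mem_filter.1 hk).2
    refine le_trans ?_ hk'
    norm_cast
    apply Finset.card_le_card
    intro x hx
    simpa using hmax x hx

lemma Fb_sum_le (q : ℝ) (hq : 0 < q) (n m : ℕ) (j : Fin m)
    (z : (Fin n ⊕ Unit → ℝ) × ({l : Fin m // l ≠ j} → ℝ)) :
    ∑ k, Fb q n m j k z ≤ (n + 1) * (q / m) := by
  have hK := bhK_pos q hq n m j z
  unfold Fb
  set K := bhKstar q m (ptil n m j z)
  have hK' : (0:ℝ) < K := by exact_mod_cast hK
  have hn : (0:ℝ) < n + 1 := by positivity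
  rw [← Finset.sum_filter, Finset.sum_const, nsmul_eq_mul]
  have h := rank_count z.1 (q * K / m * (n+1)) (by positivity)
  simp only [div_le_iff₀ hn]
  calc _ ≤ (q * K / m * (n+1)) * (1 / (K:ℝ)) := by gcongr
    _ = _ := by field_simp

lemma meas_card {Z α : Type*} [MeasurableSpace Z] [Fintype α] (P : α → Z → Prop)
    (h : ∀ a, MeasurableSet {z | P a z}) :
    Measurable (fun z => (Finset.univ.filter (fun a => P a z)).card) := by
  simp only [Finset.card_filter]
  exact Finset.measurable_sum _ (fun a _ => Measurable.ite (h a) measurable_const measurable_const)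

lemma meas_ptil (n m : ℕ) (j l : Fin m) : Measurable (fun z => ptil n m j z l) := by
  unfold ptil
  split_ifs with h
  · refine Measurable.div_const ?_ _
    refine (measurable_from_nat (f := fun x : ℕ => (x:ℝ))).comp (meas_card _ ?_)
    intro k
    exact measurableSet_lt (by fun_prop) (by fun_prop)
  · exact measurable_const

lemma meas_K (q : ℝ) (n m : ℕ) (j : Fin m) :
    Measurable (fun z => bhKstar q m (ptil n m j z)) := by
  unfold bhKstar
  apply measurable_findGreatest
  intro k _
  refine measurableSet_le measurable_const (meas_card _ ?_)
  intro l
  exact measurableSet_le (meas_ptil n m j l) measurable_const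

lemma meas_Fb (q : ℝ) (n m : ℕ) (j : Fin m) (k : Fin n ⊕ Unit) :
    Measurable (Fb q n m j k) := by
  have hK : Measurable (fun z => ((bhKstar q m (ptil n m j z) : ℕ) : ℝ)) :=
    (measurable_from_nat (f := fun x : ℕ => (x:ℝ))).comp (meas_K q n m j)
  unfold Fb
  refine Measurable.ite ?_ (measurable_const.div hK) measurable_const
  refine measurableSet_le (Measurable.div_const ?_ _) ((measurable_const.mul hK).div_const _)
  refine (measurable_from_nat (f := fun x : ℕ => (x:ℝ))).comp (meas_card _ ?_)
  intro k
  exact measurableSet_le (by fun_prop) (by fun_prop)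

lemma Fb_nonneg (q : ℝ) (n m : ℕ) (j : Fin m) (k : Fin n ⊕ Unit) (z) :
    0 ≤ Fb q n m j k z := by
  unfold Fb; split_ifs <;> positivity

lemma Fb_le_one (q : ℝ) (n m : ℕ) (j : Fin m) (k : Fin n ⊕ Unit) (z) :
    Fb q n m j k z ≤ 1 := by
  unfold Fb
  split_ifs
  · rw [one_div]; exact Nat.cast_inv_le_one _
  · exact zero_le_one

lemma Fb_integral {Ω : Type*} [MeasurableSpace Ω] (μ : Measure Ω) [IsProbabilityMeasure μ]
    (q : ℝ) (hq : 0 < q) (n m : ℕ) (j : Fin m)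
    (W : Ω → Fin n ⊕ Unit → ℝ) (U : Ω → {l : Fin m // l ≠ j} → ℝ)
    (hex : ∀ σ : Equiv.Perm (Fin n ⊕ Unit),
      IdentDistrib (fun ω => ((fun k => W ω (σ k)), U ω)) (fun ω => (W ω, U ω)) μ μ) :
    Integrable (fun ω => Fb q n m j (Sum.inr ()) (W ω, U ω)) μ ∧
    ∫ ω, Fb q n m j (Sum.inr ()) (W ω, U ω) ∂μ ≤ q / m := by
  have hint : ∀ k, Integrable (fun ω => Fb q n m j k (W ω, U ω)) μ := by
    intro k
    refine Integrable.of_bound (C := 1)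
      ((meas_Fb q n m j k).comp_aemeasurable (hex 1).aemeasurable_snd).aestronglyMeasurable ?_
    refine Filter.Eventually.of_forall fun ω => ?_
    rw [Real.norm_of_nonneg (Fb_nonneg ..)]
    exact Fb_le_one ..
  refine ⟨hint _, ?_⟩
  have heq : ∀ k, ∫ ω, Fb q n m j k (W ω, U ω) ∂μ
      = ∫ ω, Fb q n m j (Sum.inr ()) (W ω, U ω) ∂μ := by
    intro k
    have h := ((hex (Equiv.swap (Sum.inr ()) k)).comp
      (meas_Fb q n m j (Sum.inr ()))).integral_eq
    rw [show (Fb q n m j (Sum.inr ()) ∘ fun ω => (W ω, U ω))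
      = fun ω => Fb q n m j (Sum.inr ()) (W ω, U ω) from rfl] at h
    rw [← h]
    congr 1
    funext ω
    simp only [Function.comp]
    rw [Fb_perm, Equiv.swap_apply_left]
  have hsum : ∫ ω, ∑ k, Fb q n m j k (W ω, U ω) ∂μ ≤ (n + 1) * (q / m) := by
    calc _ ≤ ∫ ω, ((n:ℝ) + 1) * (q / m) ∂μ :=
          integral_mono (integrable_finsetSum _ fun k _ => hint k) (integrable_const _)
            (fun ω => Fb_sum_le q hq n m j _)
      _ = _ := by simp
  rw [integral_finsetSum _ fun k _ => hint k] at hsum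
  simp only [heq, Finset.sum_const, Finset.card_univ, nsmul_eq_mul, Fintype.card_sum,
    Fintype.card_fin, Fintype.card_unit] at hsum
  push_cast at hsum
  exact le_of_mul_le_mul_left hsum (by positivity)

lemma pointwise (q : ℝ) (hq : 0 < q) (n m : ℕ) (v : Fin n → ℝ) (u t : Fin m → ℝ)
    (a : Fin m → ℝ)
    (ha : ∀ j, a j = (1 + ((Finset.univ.filter (fun i : Fin n => v i < u j)).card : ℝ)) / (n + 1))
    (hne : ∀ i j, v i ≠ u j) (j : Fin m) (hj : j ∈ bhReject q m a) (hnull : t j ≤ u j) :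
    1 / max 1 ((bhReject q m a).card : ℝ) ≤
      Fb q n m j (Sum.inr ()) (Sum.elim v (fun _ => t j), fun l => u l.1) := by
  have hn : (0:ℝ) < n + 1 := by positivity
  have hjr : a j ≤ q * (bhKstar q m a : ℕ) / m := by
    simpa [bhReject] using hj
  have hlt : ∀ x : ℝ, (Finset.univ.filter
        (fun k : Fin n ⊕ Unit => Sum.elim v (fun _ => t j) k < x)).card
      = (Finset.univ.filter (fun i => v i < x)).card + (if t j < x then 1 else 0) := by
    intro x
    rw [Finset.card_filter, Finset.card_filter, Fintype.sum_sum_type]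
    simp only [Finset.univ_unique, Finset.sum_singleton]
    rfl
  have hle : ∀ x : ℝ, (Finset.univ.filter
        (fun k : Fin n ⊕ Unit => Sum.elim v (fun _ => t j) k ≤ x)).card
      = (Finset.univ.filter (fun i => v i ≤ x)).card + (if t j ≤ x then 1 else 0) := by
    intro x
    rw [Finset.card_filter, Finset.card_filter, Fintype.sum_sum_type]
    simp only [Finset.univ_unique, Finset.sum_singleton]
    rfl
  have hK : bhKstar q m (ptil n m j (Sum.elim v (fun _ => t j), fun l => u l.1))
      = bhKstar q m a := by
    apply bhK_congr q hq
    · intro l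
      unfold ptil
      rw [ha]
      split_ifs with h
      · dsimp only
        rw [hlt]
        apply div_le_div_of_nonneg_right _ hn.le
        split_ifs <;> push_cast <;> linarith
      · positivity
    · intro l
      by_cases h : l = j
      · right; rw [h]; exact hjr
      · rcases lt_or_ge (t j) (u l) with h2 | h2
        · left
          unfold ptil
          rw [dif_pos h]
          dsimp only
          rw [hlt, ha, if_pos h2]
          push_cast
          ring
        · right
          refine le_trans ?_ hjr
          rw [ha, ha]
          gcongr
          exact h2.trans hnull
  have hpos : 1 ≤ bhKstar q m a := hK ▸ bhK_pos q hq n m j _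
  unfold Fb
  rw [hK, bh_card q hq, if_pos, max_eq_right (by exact_mod_cast hpos)]
  refine le_trans ?_ hjr
  rw [ha]
  dsimp only
  rw [hle, if_pos (by exact le_rfl)]
  push_cast
  rw [add_comm]
  apply div_le_div_of_nonneg_right _ hn.le
  have : (Finset.univ.filter (fun i => v i ≤ t j)).card
      ≤ (Finset.univ.filter (fun i => v i < u j)).card := by
    apply Finset.card_le_card
    intro i hi
    rw [Finset.mem_filter] at hi ⊢
    exact ⟨hi.1, lt_of_le_of_ne (hi.2.trans hnull) (hne _ _)⟩
  have h2 : ((Finset.univ.filter (fun i => v i ≤ t j)).card : ℝ)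
      ≤ (Finset.univ.filter (fun i => v i < u j)).card := by exact_mod_cast this
  exact add_le_add_right h2 1

/-- Theorem 2 of the paper: if the nonconformity score `V` is monotone, for
every `j` the scores `(V_1,…,V_n, V_{n+j})` are exchangeable conditional on
`(V̂_{n+ℓ})_{ℓ≠j}` (formalized: jointly with `(V̂_{n+ℓ})_{ℓ≠j}`, permuting
`(V_1,…,V_n,V_{n+j})` does not change the joint distribution), and the scores
`{V_i}_{i≤n} ∪ {V̂_{n+ℓ}}_{ℓ≤m}` almost surely have no ties, then the BH procedure at level
`q ∈ (0,1)` applied to the deterministic conformal p-values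
`p_j^dtm = (1 + #{i : V_i < V̂_{n+j}})/(n+1)` controls the FDR at level `q`. -/
theorem conformal_selection_FDR_control_exchangeable
    {Ω 𝒳 : Type*} [MeasurableSpace Ω] [MeasurableSpace 𝒳]
    (μ : Measure Ω) [IsProbabilityMeasure μ]
    (n m : ℕ)
    (Xc : Fin n → Ω → 𝒳) (Yc : Fin n → Ω → ℝ)
    (Xt : Fin m → Ω → 𝒳) (Yt : Fin m → Ω → ℝ)
    (c : Fin m → ℝ) (V : 𝒳 → ℝ → ℝ)
    -- measurability
    (hXc : ∀ i, Measurable (Xc i)) (hYc : ∀ i, Measurable (Yc i))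
    (hXt : ∀ j, Measurable (Xt j)) (hYt : ∀ j, Measurable (Yt j))
    (hV : Measurable (fun z : 𝒳 × ℝ => V z.1 z.2))
    -- the nonconformity score is monotone in its second argument
    (hmono : ∀ x : 𝒳, Monotone (V x))
    -- conditional exchangeability of (V_1,…,V_n,V_{n+j}) given (V̂_{n+ℓ})_{ℓ≠j}
    (hexch : ∀ (j : Fin m) (σ : Equiv.Perm (Fin n ⊕ Unit)),
      IdentDistrib
        (fun ω =>
          ((fun k : Fin n ⊕ Unit =>
              Sum.elim (fun i => V (Xc i ω) (Yc i ω))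
                (fun _ => V (Xt j ω) (Yt j ω)) (σ k)),
           (fun ℓ : {ℓ : Fin m // ℓ ≠ j} => V (Xt ℓ.1 ω) (c ℓ.1))))
        (fun ω =>
          ((fun k : Fin n ⊕ Unit =>
              Sum.elim (fun i => V (Xc i ω) (Yc i ω))
                (fun _ => V (Xt j ω) (Yt j ω)) k),
           (fun ℓ : {ℓ : Fin m // ℓ ≠ j} => V (Xt ℓ.1 ω) (c ℓ.1))))
        μ μ)
    -- almost surely no ties among {V_i}_{i=1}^n ∪ {V̂_{n+ℓ}}_{ℓ=1}^m
    (hnoties : ∀ᵐ ω ∂μ, Function.Injective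
      (fun k : Fin n ⊕ Fin m =>
        Sum.elim (fun i => V (Xc i ω) (Yc i ω)) (fun ℓ => V (Xt ℓ ω) (c ℓ)) k))
    -- the deterministic conformal p-values
    (p : Fin m → Ω → ℝ)
    (hp : ∀ j ω, p j ω =
      (1 + ((Finset.univ.filter
        (fun i : Fin n => V (Xc i ω) (Yc i ω) < V (Xt j ω) (c j))).card : ℝ)) / (n + 1))
    -- the FDR target level
    (q : ℝ) (hq0 : 0 < q) (hq1 : q < 1) :
    (∫ ω, ((((bhReject q m (fun j => p j ω)).filter (fun j => Yt j ω ≤ c j)).card : ℝ)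
        / max 1 (((bhReject q m (fun j => p j ω)).card : ℝ))) ∂μ) ≤ q := by
  have key : ∀ j : Fin m, _ := fun j => Fb_integral μ q hq0 n m j
    (fun ω => Sum.elim (fun i => V (Xc i ω) (Yc i ω)) (fun _ => V (Xt j ω) (Yt j ω)))
    (fun ω l => V (Xt l.1 ω) (c l.1)) (hexch j)
  calc _ ≤ ∫ ω, ∑ j, Fb q n m j (Sum.inr ())
        (Sum.elim (fun i => V (Xc i ω) (Yc i ω)) (fun _ => V (Xt j ω) (Yt j ω)),
          fun l => V (Xt l.1 ω) (c l.1)) ∂μ := by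
        refine integral_mono_of_nonneg (Filter.Eventually.of_forall fun ω => ?_)
          (integrable_finsetSum _ fun j _ => (key j).1) ?_
        · simp only [Pi.zero_apply]
          positivity
        · filter_upwards [hnoties] with ω hω
          rw [div_eq_mul_one_div, ← nsmul_eq_mul, ← Finset.sum_const]
          refine le_trans (Finset.sum_le_sum (g := fun j => Fb q n m j (Sum.inr ())
            (Sum.elim (fun i => V (Xc i ω) (Yc i ω)) (fun _ => V (Xt j ω) (Yt j ω)),
              fun l => V (Xt l.1 ω) (c l.1))) ?_)
            (Finset.sum_le_sum_of_subset_of_nonneg (Finset.subset_univ _)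
              fun _ _ _ => Fb_nonneg ..)
          intro j hj
          rw [Finset.mem_filter] at hj
          refine pointwise q hq0 n m (fun i => V (Xc i ω) (Yc i ω)) (fun l => V (Xt l ω) (c l))
            (fun l => V (Xt l ω) (Yt l ω)) (fun j => p j ω) (fun j => hp j ω) ?_ j hj.1
            (hmono _ hj.2)
          intro i l h
          have := @hω (Sum.inl i) (Sum.inr l) h
          cases this
    _ ≤ ∑ j : Fin m, q / m := by
        rw [integral_finsetSum _ fun j _ => (key j).1]
        exact Finset.sum_le_sum fun j _ => (key j).2
    _ ≤ q := by
        rw [Finset.sum_const, Finset.card_univ, Fintype.card_fin, nsmul_eq_mul]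
        rcases Nat.eq_zero_or_pos m with h | h
        · subst h; simpa using hq0.le
        · have : (0:ℝ) < m := by exact_mod_cast h
          rw [mul_div_cancel₀ _ this.ne']
end

section
/- Let W_1,…,W_{n+1} be exchangeable real-valued random variables that almost surely have no ties, and set p = (1 + Σ_{i=1}^n 1{W_i < W_{n+1}})/(n+1). Then, conditional on the order statistics (W_{(1)},…,W_{(n+1)}), p is uniformly distributed on {1/(n+1), 2/(n+1), …, 1}. Consequently, for any random variable T taking values in [0,1] that is measurable with respect to the σ-algebra generated by the order statistics, P(p ≤ T | W_{(1)},…,W_{(n+1)}) ≤ T almost surely, and in particular P(p ≤ t) ≤ t for every deterministic t ∈ [0,1]. -/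
set_option autoImplicit false

open MeasureTheory ProbabilityTheory Finset
open scoped Classical

/-- normalized rank of coordinate `j` -/
noncomputable def rkAux (n : ℕ) (j : Fin (n + 1)) (x : Fin (n + 1) → ℝ) : ℝ :=
  (1 + ∑ i, if x i < x j then (1 : ℝ) else 0) / (n + 1)

lemma measurable_rkAux (n : ℕ) (j : Fin (n + 1)) : Measurable (rkAux n j) := by
  unfold rkAux
  refine Measurable.div_const (Measurable.const_add (Finset.measurable_sum _ fun i _ => ?_) _) _
  exact Measurable.ite (measurableSet_lt (measurable_pi_apply i) (measurable_pi_apply j))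
    measurable_const measurable_const

lemma rkAux_perm (n : ℕ) (j : Fin (n + 1)) (x : Fin (n + 1) → ℝ)
    (σ : Equiv.Perm (Fin (n + 1))) : rkAux n j (fun k => x (σ k)) = rkAux n (σ j) x := by
  unfold rkAux
  rw [Equiv.sum_comp σ (fun i => if x i < x (σ j) then (1 : ℝ) else 0)]

lemma sum_rkAux (n : ℕ) (x : Fin (n + 1) → ℝ) (hx : Function.Injective x) (f : ℝ → ENNReal) :
    ∑ j, f (rkAux n j x) = ∑ k : Fin (n + 1), f ((((k : ℕ) : ℝ) + 1) / ((n : ℝ) + 1)) := by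
  let c : Fin (n + 1) → Finset (Fin (n + 1)) := fun j => Finset.univ.filter (fun i => x i < x j)
  have hlt : ∀ j, (c j).card < n + 1 := by
    intro j
    have : (c j) ⊂ Finset.univ := by
      rw [Finset.ssubset_univ_iff]
      intro h
      have : j ∈ c j := h ▸ Finset.mem_univ j
      simp [c] at this
    simpa using Finset.card_lt_card this
  have hmono : ∀ i j, x i < x j → (c i).card < (c j).card := by
    intro i j hij
    apply Finset.card_lt_card
    rw [Finset.ssubset_iff_of_subset]
    · exact ⟨i, by simp [c, hij], by simp [c]⟩
    · intro k hk
      simp only [c, Finset.mem_filter, Finset.mem_univ, true_and] at hk ⊢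
      exact hk.trans hij
  let r : Fin (n + 1) → Fin (n + 1) := fun j => ⟨(c j).card, hlt j⟩
  have hr : Function.Injective r := by
    intro i j hij
    have h : (c i).card = (c j).card := congrArg Fin.val hij
    by_contra hne
    rcases lt_or_gt_of_ne (hx.ne hne) with h1 | h1
    · have := hmono _ _ h1; omega
    · have := hmono _ _ h1; omega
  have hb : Function.Bijective r := Finite.injective_iff_bijective.mp hr
  rw [← hb.sum_comp (fun k : Fin (n + 1) => f ((((k : ℕ) : ℝ) + 1) / ((n : ℝ) + 1)))]
  refine Finset.sum_congr rfl fun j _ => ?_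
  congr 1
  unfold rkAux
  simp [r, c, add_comm]

lemma measurable_sortAux (n : ℕ) :
    Measurable (fun x : Fin (n + 1) → ℝ => x ∘ Tuple.sort x) := by
  let _ : MeasurableSpace (Equiv.Perm (Fin (n + 1))) := ⊤
  have : MeasurableSingletonClass (Equiv.Perm (Fin (n + 1))) := ⟨fun _ => trivial⟩
  have h1 : Measurable (fun x : Fin (n + 1) → ℝ => Tuple.sort x) := by
    refine measurable_to_countable' fun σ => ?_
    have : (fun x : Fin (n + 1) → ℝ => Tuple.sort x) ⁻¹' {σ} =
        (⋂ i, ⋂ j, {x | i ≤ j → x (σ i) ≤ x (σ j)}) ∩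
        (⋂ i, ⋂ j, {x | i < j → x (σ i) = x (σ j) → σ i < σ j}) := by
      ext x
      simp only [Set.mem_preimage, Set.mem_singleton_iff, Set.mem_inter_iff, Set.mem_iInter,
        Set.mem_ofPred_eq]
      rw [eq_comm, Tuple.eq_sort_iff]
      rfl
    rw [this]
    refine (MeasurableSet.iInter fun i => MeasurableSet.iInter fun j => ?_).inter
      (MeasurableSet.iInter fun i => MeasurableSet.iInter fun j => ?_)
    · exact (MeasurableSet.const _).imp
        (measurableSet_le (measurable_pi_apply _) (measurable_pi_apply _))
    · exact (MeasurableSet.const _).imp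
        ((measurableSet_eq_fun (measurable_pi_apply (σ i)) (measurable_pi_apply (σ j))).imp
          (MeasurableSet.const _))
  have h2 : Measurable (fun q : (Fin (n + 1) → ℝ) × Equiv.Perm (Fin (n + 1)) =>
      (q.1 ∘ q.2 : Fin (n + 1) → ℝ)) :=
    measurable_from_prod_countable_left fun σ =>
      measurable_pi_lambda _ fun i => measurable_pi_apply (σ i)
  exact h2.comp (measurable_id.prodMk h1)

/-- the uniform law -/
noncomputable def unifAux (n : ℕ) : Measure ℝ :=
  (((n : ENNReal) + 1)⁻¹ : ENNReal) •
    ∑ k : Fin (n + 1), Measure.dirac ((((k : ℕ) : ℝ) + 1) / ((n : ℝ) + 1))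

lemma unifAux_apply (n : ℕ) (B : Set ℝ) (hB : MeasurableSet B) :
    unifAux n B = ((n : ENNReal) + 1)⁻¹ *
      ∑ k : Fin (n + 1), B.indicator 1 ((((k : ℕ) : ℝ) + 1) / ((n : ℝ) + 1)) := by
  simp [unifAux, Measure.smul_apply, hB]

instance (n : ℕ) : IsProbabilityMeasure (unifAux n) := by
  constructor
  rw [unifAux_apply n _ MeasurableSet.univ]
  simp only [Set.indicator_univ, Pi.one_apply, Finset.sum_const, Finset.card_univ,
    Fintype.card_fin, nsmul_eq_mul, mul_one, Nat.cast_add, Nat.cast_one]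
  exact ENNReal.inv_mul_cancel (by simp) (by simp)

lemma unifAux_Iic (n : ℕ) (t : ℝ) (ht : 0 ≤ t) :
    unifAux n (Set.Iic t) ≤ ENNReal.ofReal t := by
  have hn : (0 : ℝ) < (n : ℝ) + 1 := by positivity
  rw [unifAux_apply n _ measurableSet_Iic, mul_comm, ← div_eq_mul_inv]
  refine ENNReal.div_le_of_le_mul ?_
  have h1 : (∑ k : Fin (n + 1), (Set.Iic t).indicator (1 : ℝ → ENNReal)
      ((((k : ℕ) : ℝ) + 1) / ((n : ℝ) + 1))) =
      ((Finset.univ.filter (fun k : Fin (n + 1) =>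
        (((k : ℕ) : ℝ) + 1) / ((n : ℝ) + 1) ≤ t)).card : ENNReal) := by
    simp [Set.indicator_apply]
  have h2 : (Finset.univ.filter (fun k : Fin (n + 1) =>
        (((k : ℕ) : ℝ) + 1) / ((n : ℝ) + 1) ≤ t)).card ≤ ⌊t * (n + 1)⌋₊ := by
    rw [← Finset.card_range ⌊t * (n + 1)⌋₊]
    refine Finset.card_le_card_of_injOn (fun k => (k : ℕ)) ?_ ?_
    · intro k hk
      have hk' : (((k : ℕ) : ℝ) + 1) / ((n : ℝ) + 1) ≤ t := by simpa using hk
      rw [div_le_iff₀ hn] at hk'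
      have : (k : ℕ) + 1 ≤ ⌊t * (n + 1)⌋₊ := Nat.le_floor (by push_cast; exact hk')
      simp only [Finset.coe_range, Set.mem_Iio]
      omega
    · intro a _ b _ hab
      exact Fin.ext hab
  rw [h1]
  have h3 : ((n : ENNReal) + 1) = ENNReal.ofReal ((n : ℝ) + 1) := by
    rw [ENNReal.ofReal_add (by positivity) (by norm_num)]; simp
  rw [h3, ← ENNReal.ofReal_mul ht, ← ENNReal.ofReal_natCast]
  apply ENNReal.ofReal_le_ofReal
  calc _ ≤ ((⌊t * (n + 1)⌋₊ : ℕ) : ℝ) := by exact_mod_cast h2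
    _ ≤ _ := Nat.floor_le (by positivity)

/-- if `W_1,…,W_{n+1}` are exchangeable with no ties a.s., then conditional on
the order statistics, `p = (1 + #{i ≤ n : W_i < W_{n+1}})/(n+1)` is uniform on
`{1/(n+1),…,1}`; consequently `P(p ≤ T | order statistics) ≤ T` a.s. for every `[0,1]`-valued
`T` measurable w.r.t. the order statistics, and `P(p ≤ t) ≤ t` for deterministic `t ∈ [0,1]`. -/
theorem exchangeable_rank_pvalue_conditionally_uniform
    {Ω : Type*} [MeasurableSpace Ω]
    (μ : Measure Ω) [IsProbabilityMeasure μ]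
    (n : ℕ)
    (W : Fin (n + 1) → Ω → ℝ)
    (hW : ∀ k, Measurable (W k))
    -- exchangeability
    (hexch : ∀ σ : Equiv.Perm (Fin (n + 1)),
      IdentDistrib (fun ω => fun k => W (σ k) ω) (fun ω => fun k => W k ω) μ μ)
    -- no ties almost surely
    (hnoties : ∀ i j : Fin (n + 1), i ≠ j → μ {ω | W i ω = W j ω} = 0)
    -- the rank-based p-value
    (p : Ω → ℝ)
    (hp : ∀ ω, p ω =
      (1 + ((Finset.univ.filter
        (fun i : Fin n => W i.castSucc ω < W (Fin.last n) ω)).card : ℝ)) / (n + 1))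
    -- the vector of order statistics
    (S : Ω → (Fin (n + 1) → ℝ))
    (hS : ∀ ω, S ω = (fun k => W k ω) ∘ (Tuple.sort (fun k => W k ω))) :
    -- (1) conditionally on the order statistics, p is uniform on {1/(n+1),…,1}
    (∀ᵐ s ∂(μ.map S), condDistrib p S μ s
        = (((n : ENNReal) + 1)⁻¹ : ENNReal) •
            ∑ k : Fin (n + 1), Measure.dirac ((((k : ℕ) : ℝ) + 1) / ((n : ℝ) + 1)))
    ∧
    -- (2) P(p ≤ T | order statistics) ≤ T a.s. for T measurable w.r.t. the order statistics
    (∀ T : Ω → ℝ,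
      Measurable[MeasurableSpace.comap S inferInstance] T →
      (∀ ω, T ω ∈ Set.Icc (0 : ℝ) 1) →
      ∀ᵐ ω ∂μ,
        (μ[Set.indicator {ω' | p ω' ≤ T ω'} (fun _ => (1 : ℝ))
            | MeasurableSpace.comap S inferInstance]) ω ≤ T ω)
    ∧
    -- (3) P(p ≤ t) ≤ t for every deterministic t ∈ [0,1]
    (∀ t : ℝ, 0 ≤ t → t ≤ 1 → μ {ω | p ω ≤ t} ≤ ENNReal.ofReal t) := by
  let V : Ω → (Fin (n + 1) → ℝ) := fun ω k => W k ω
  have hV : Measurable V := measurable_pi_lambda _ hW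
  have hSV : S = (fun x : Fin (n + 1) → ℝ => x ∘ Tuple.sort x) ∘ V := funext hS
  have hSm : Measurable S := hSV ▸ (measurable_sortAux n).comp hV
  have hpV : p = rkAux n (Fin.last n) ∘ V := by
    funext ω
    rw [hp ω]
    unfold rkAux
    rw [Function.comp_apply, Fin.sum_univ_castSucc]
    simp [V]
  have hpm : Measurable p := hpV ▸ (measurable_rkAux n _).comp hV
  have hinj : ∀ᵐ ω ∂μ, Function.Injective (V ω) := by
    have : ∀ᵐ ω ∂μ, ∀ i j : Fin (n + 1), i ≠ j → W i ω ≠ W j ω := by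
      rw [ae_all_iff]; intro i
      rw [ae_all_iff]; intro j
      by_cases hij : i = j
      · simp [hij]
      · have := hnoties i j hij
        rw [ae_iff]
        simpa [hij] using this
    filter_upwards [this] with ω h i j hij
    by_contra hne
    exact h i j hne hij
  have key : ∀ A : Set (Fin (n + 1) → ℝ), MeasurableSet A → ∀ B : Set ℝ, MeasurableSet B →
      μ (S ⁻¹' A ∩ p ⁻¹' B) = μ (S ⁻¹' A) * unifAux n B := by
    intro A hA B hB
    have hE : ∀ j, MeasurableSet (S ⁻¹' A ∩ (rkAux n j ∘ V) ⁻¹' B) := fun j =>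
      (hSm hA).inter (((measurable_rkAux n j).comp hV) hB)
    have hj : ∀ j, μ (S ⁻¹' A ∩ (rkAux n j ∘ V) ⁻¹' B) = μ (S ⁻¹' A ∩ p ⁻¹' B) := by
      intro j
      let σ : Equiv.Perm (Fin (n + 1)) := Equiv.swap j (Fin.last n)
      have hD : MeasurableSet ((fun x : Fin (n + 1) → ℝ => x ∘ Tuple.sort x) ⁻¹' A ∩
          (rkAux n (Fin.last n)) ⁻¹' B) :=
        (measurable_sortAux n hA).inter (measurable_rkAux n _ hB)
      have := (hexch σ).measure_mem_eq hD
      have e1 : (fun ω => fun k => W (σ k) ω) ⁻¹'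
          ((fun x : Fin (n + 1) → ℝ => x ∘ Tuple.sort x) ⁻¹' A ∩ (rkAux n (Fin.last n)) ⁻¹' B)
          = S ⁻¹' A ∩ (rkAux n j ∘ V) ⁻¹' B := by
        ext ω
        have a1 : (fun k => W (σ k) ω) ∘ Tuple.sort (fun k => W (σ k) ω) = S ω := by
          rw [hS ω]
          exact Tuple.comp_perm_comp_sort_eq_comp_sort (f := V ω) (σ := σ)
        have a2 : rkAux n (Fin.last n) (fun k => W (σ k) ω) = rkAux n j (V ω) := by
          have := rkAux_perm n (Fin.last n) (V ω) σ
          simpa [σ, V] using this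
        simp only [Set.mem_inter_iff, Set.mem_preimage, a1, a2, Function.comp_apply]
      have e2 : (fun ω => fun k => W k ω) ⁻¹'
          ((fun x : Fin (n + 1) → ℝ => x ∘ Tuple.sort x) ⁻¹' A ∩ (rkAux n (Fin.last n)) ⁻¹' B)
          = S ⁻¹' A ∩ p ⁻¹' B := by
        rw [hSV, hpV]; rfl
      rw [e1, e2] at this
      exact this
    have hsum : ((n : ENNReal) + 1) * μ (S ⁻¹' A ∩ p ⁻¹' B) =
        μ (S ⁻¹' A) * ∑ k : Fin (n + 1),
          B.indicator 1 ((((k : ℕ) : ℝ) + 1) / ((n : ℝ) + 1)) := by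
      calc ((n : ENNReal) + 1) * μ (S ⁻¹' A ∩ p ⁻¹' B)
          = ∑ j : Fin (n + 1), μ (S ⁻¹' A ∩ (rkAux n j ∘ V) ⁻¹' B) := by
            simp [hj]
        _ = ∑ j : Fin (n + 1), ∫⁻ ω in S ⁻¹' A, B.indicator 1 (rkAux n j (V ω)) ∂μ := by
            refine Finset.sum_congr rfl fun j _ => ?_
            have hm := ((measurable_rkAux n j).comp hV) hB
            have : (fun ω => B.indicator (1 : ℝ → ENNReal) (rkAux n j (V ω))) =
              ((rkAux n j ∘ V) ⁻¹' B).indicator 1 := rfl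
            rw [this, lintegral_indicator_one hm, Measure.restrict_apply hm, Set.inter_comm]
        _ = ∫⁻ ω in S ⁻¹' A, ∑ j : Fin (n + 1), B.indicator 1 (rkAux n j (V ω)) ∂μ := by
            rw [lintegral_finsetSum]
            intro j _
            exact (measurable_one.indicator hB).comp ((measurable_rkAux n j).comp hV)
        _ = ∫⁻ ω in S ⁻¹' A, ∑ k : Fin (n + 1),
              B.indicator 1 ((((k : ℕ) : ℝ) + 1) / ((n : ℝ) + 1)) ∂μ := by
            refine lintegral_congr_ae (ae_restrict_of_ae ?_)
            filter_upwards [hinj] with ω hω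
            exact sum_rkAux n (V ω) hω (B.indicator 1)
        _ = _ := by
            rw [lintegral_const, Measure.restrict_apply_univ, mul_comm]
    rw [unifAux_apply n B hB, mul_left_comm, ← hsum, ← mul_assoc,
      ENNReal.inv_mul_cancel (by simp) (by simp), one_mul]
  have hcd : ∀ᵐ s ∂(μ.map S), condDistrib p S μ s = unifAux n := by
    have hpr : IsProbabilityMeasure (μ.map S) := Measure.isProbabilityMeasure_map hSm.aemeasurable
    have : condDistrib p S μ =ᵐ[μ.map S] Kernel.const _ (unifAux n) := by
      refine condDistrib_ae_eq_of_measure_eq_compProd S hpm.aemeasurable ?_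
      rw [Measure.compProd_const]
      symm
      refine Measure.prod_eq fun A B hA hB => ?_
      rw [Measure.map_apply (hSm.prodMk hpm) (hA.prod hB), Measure.map_apply hSm hA,
        ← key A hA B hB]
      rfl
    filter_upwards [this] with s hs
    rw [hs, Kernel.const_apply]
  refine ⟨hcd, ?_, ?_⟩
  · intro T hT hT01
    obtain ⟨g, hg, hgT⟩ := hT.exists_eq_measurable_comp
    have hC : MeasurableSet {q : (Fin (n + 1) → ℝ) × ℝ | q.2 ≤ g q.1} :=
      measurableSet_le measurable_snd (hg.comp measurable_fst)
    let f : (Fin (n + 1) → ℝ) × ℝ → ℝ :=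
      Set.indicator {q : (Fin (n + 1) → ℝ) × ℝ | q.2 ≤ g q.1} (fun _ => (1 : ℝ))
    have hpr : IsProbabilityMeasure (μ.map fun a => (S a, p a)) :=
      Measure.isProbabilityMeasure_map (hSm.prodMk hpm).aemeasurable
    have hf : Integrable f (μ.map fun a => (S a, p a)) :=
      (integrable_const (1 : ℝ)).indicator hC
    have h1 := condExp_prod_ae_eq_integral_condDistrib' hSm hpm.aemeasurable hf
    have h2 := ae_of_ae_map hSm.aemeasurable hcd
    have h3 : Set.indicator {ω' | p ω' ≤ T ω'} (fun _ => (1 : ℝ)) = fun a => f (S a, p a) := by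
      funext a
      simp [f, Set.indicator_apply, hgT]
    rw [h3]
    filter_upwards [h1, h2] with ω hω1 hω2
    rw [hω1, hω2]
    have h4 : (fun y => f (S ω, y)) = (Set.Iic (T ω)).indicator 1 := by
      funext y
      simp [f, Set.indicator_apply, hgT]
    rw [h4, integral_indicator_one measurableSet_Iic]
    exact ENNReal.toReal_le_of_le_ofReal (hT01 ω).1 (unifAux_Iic n _ (hT01 ω).1)
  · intro t ht _
    have := key Set.univ MeasurableSet.univ (Set.Iic t) measurableSet_Iic
    simp only [Set.preimage_univ, Set.univ_inter, measure_univ, one_mul] at this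
    change μ (p ⁻¹' Set.Iic t) ≤ _
    rw [this]
    exact unifAux_Iic n t ht
end

section
/- Fix q ∈ (0,1), integers n, m ≥ 1 and an index j ∈ {1,…,m}. Let v_1,…,v_n and v̂_1,…,v̂_m be real numbers such that no two elements of {v_1,…,v_n, v̂_1,…,v̂_m} are equal, and let w ∈ ℝ with w ≤ v̂_j. Define p_ℓ = (1 + Σ_{i=1}^n 1{v_i < v̂_ℓ})/(n+1) for ℓ = 1,…,m, p* = (1 + Σ_{i=1}^n 1{v_i < w})/(n+1), and p_ℓ^{(j)} = (Σ_{i=1}^n 1{v_i < v̂_ℓ} + 1{w < v̂_ℓ})/(n+1) for ℓ ≠ j. Let ℛ be the BH rejection set at level q applied to (p_1,…,p_m). If j ∈ ℛ, then the BH rejection set at level q applied to (p_1^{(j)},…,p_{j-1}^{(j)}, p*, p_{j+1}^{(j)},…,p_m^{(j)}) equals ℛ. -/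
set_option autoImplicit false

open Finset
open scoped Classical

/-- replacing the `j`-th (deterministic) conformal p-value by its oracle
counterpart built from `w ≤ v̂_j`, and every other p-value `p_ℓ` by the leave-one-out
version `p_ℓ^{(j)}`, does not change the BH rejection set, provided `j` was rejected. -/
theorem bh_rejection_set_invariant_oracle_replacement
    (q : ℝ) (hq0 : 0 < q) (hq1 : q < 1)
    (n m : ℕ) (hn : 1 ≤ n) (hm : 1 ≤ m) (j : Fin m)
    (v : Fin n → ℝ) (vhat : Fin m → ℝ)
    (hnoties : Function.Injective (Sum.elim v vhat : Fin n ⊕ Fin m → ℝ))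
    (w : ℝ) (hw : w ≤ vhat j)
    (p : Fin m → ℝ)
    (hp : ∀ ℓ, p ℓ =
      (1 + ((Finset.univ.filter (fun i : Fin n => v i < vhat ℓ)).card : ℝ)) / (n + 1))
    (pstar : ℝ)
    (hpstar : pstar =
      (1 + ((Finset.univ.filter (fun i : Fin n => v i < w)).card : ℝ)) / (n + 1))
    (p' : Fin m → ℝ)
    (hp'j : p' j = pstar)
    (hp' : ∀ ℓ, ℓ ≠ j → p' ℓ =
      (((Finset.univ.filter (fun i : Fin n => v i < vhat ℓ)).card : ℝ)
        + (if w < vhat ℓ then (1 : ℝ) else 0)) / (n + 1))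
    (hj : j ∈ bhReject q m p) :
    bhReject q m p' = bhReject q m p := by
  have hn1 : (0:ℝ) < n + 1 := by positivity
  have hmono : ∀ x y : ℝ, x ≤ y →
      ((Finset.univ.filter (fun i : Fin n => v i < x)).card : ℝ) ≤
      ((Finset.univ.filter (fun i : Fin n => v i < y)).card : ℝ) := by
    intro x y hxy
    have := Finset.card_le_card (Finset.monotone_filter_right (Finset.univ : Finset (Fin n))
      (p := fun i => v i < x) (q := fun i => v i < y) (fun i _ hi => lt_of_lt_of_le hi hxy))
    exact_mod_cast this
  have hle : ∀ ℓ, p' ℓ ≤ p ℓ := by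
    intro ℓ
    by_cases h : ℓ = j
    · subst h
      rw [hp'j, hpstar, hp]
      have := hmono _ _ hw
      gcongr
    · rw [hp' ℓ h, hp, add_comm]
      gcongr
      split_ifs <;> norm_num
  have hor : ∀ ℓ, p' ℓ = p ℓ ∨ p ℓ ≤ p j := by
    intro ℓ
    by_cases h : ℓ = j
    · subst h
      exact Or.inr le_rfl
    · by_cases hlt : w < vhat ℓ
      · left
        rw [hp' ℓ h, hp, if_pos hlt, add_comm]
      · right
        rw [hp, hp j]
        have := hmono _ _ ((not_lt.mp hlt).trans hw)
        gcongr
  have hjk : p j ≤ q * (bhKstar q m p) / m := by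
    simpa [bhReject] using hj
  have key : ∀ k : ℕ, bhKstar q m p ≤ k →
      (Finset.univ : Finset (Fin m)).filter (fun j => p' j ≤ q * k / m) =
      (Finset.univ : Finset (Fin m)).filter (fun j => p j ≤ q * k / m) := by
    intro k hk
    have hkk : q * (bhKstar q m p) / m ≤ q * k / m := by gcongr
    ext ℓ
    simp only [Finset.mem_filter, Finset.mem_univ, true_and]
    constructor
    · intro h
      rcases hor ℓ with e | e
      · rw [← e]; exact h
      · exact e.trans (hjk.trans hkk)
    · exact fun h => (hle ℓ).trans h
  have hspec : ∀ a : Fin m → ℝ, bhKstar q m a ≤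
      ((Finset.univ : Finset (Fin m)).filter (fun j => a j ≤ q * (bhKstar q m a) / m)).card :=
    fun a => Nat.findGreatest_spec (P := fun k => k ≤ ((Finset.univ : Finset (Fin m)).filter
      (fun j => a j ≤ q * k / m)).card) (Nat.zero_le m) (Nat.zero_le _)
  have hmax : ∀ (a : Fin m → ℝ) (k : ℕ), k ≤ m → k ≤
      ((Finset.univ : Finset (Fin m)).filter (fun j => a j ≤ q * k / m)).card →
      k ≤ bhKstar q m a :=
    fun a k h1 h2 => Nat.le_findGreatest (P := fun k => k ≤ ((Finset.univ :
      Finset (Fin m)).filter (fun j => a j ≤ q * k / m)).card) h1 h2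
  have hbd : ∀ a : Fin m → ℝ, bhKstar q m a ≤ m := fun a => Nat.findGreatest_le m
  have h1 : bhKstar q m p ≤ bhKstar q m p' := by
    apply hmax p' _ (hbd p)
    rw [key _ le_rfl]
    exact hspec p
  have h2 : bhKstar q m p' ≤ bhKstar q m p := by
    apply hmax p _ (hbd p')
    rw [← key _ h1]
    exact hspec p'
  have heq := le_antisymm h2 h1
  unfold bhReject
  rw [heq]
  exact key _ le_rfl
end

section
/- Fix q ∈ (0,1) and m ≥ 1. Let (a_1,…,a_m) ∈ [0,1]^m and let ℛ be the BH rejection set at level q applied to (a_1,…,a_m). If j ∈ ℛ and (a′_1,…,a′_m) ∈ [0,1]^m satisfies a′_j ≤ a_j and a′_ℓ = a_ℓ for all ℓ ≠ j, then the BH rejection set at level q applied to (a′_1,…,a′_m) equals ℛ; that is, decreasing the p-value of a rejected hypothesis while keeping all other p-values fixed does not change the BH rejection set. -/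
set_option autoImplicit false

open Finset
open scoped Classical

/-- decreasing the p-value of a rejected hypothesis, keeping all other
p-values fixed, does not change the BH rejection set. -/
theorem bh_rejection_set_invariant_under_decrease_of_rejected
    (q : ℝ) (hq0 : 0 < q) (hq1 : q < 1) (m : ℕ) (hm : 1 ≤ m)
    (a a' : Fin m → ℝ)
    (ha : ∀ j, a j ∈ Set.Icc (0 : ℝ) 1) (ha' : ∀ j, a' j ∈ Set.Icc (0 : ℝ) 1)
    (j : Fin m) (hj : j ∈ bhReject q m a)
    (hle : a' j ≤ a j) (heq : ∀ ℓ, ℓ ≠ j → a' ℓ = a ℓ) :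
    bhReject q m a' = bhReject q m a := by
  have hjK : a j ≤ q * (bhKstar q m a : ℕ) / m := by
    simpa [bhReject] using hj
  have key : ∀ k : ℕ, bhKstar q m a ≤ k →
      (Finset.univ : Finset (Fin m)).filter (fun i => a' i ≤ q * k / m) =
      (Finset.univ : Finset (Fin m)).filter (fun i => a i ≤ q * k / m) := by
    intro k hk
    have h1 : a j ≤ q * k / m := by
      refine hjK.trans ?_
      have : ((bhKstar q m a : ℕ) : ℝ) ≤ k := by exact_mod_cast hk
      gcongr
    apply Finset.filter_congr
    intro i _
    by_cases hi : i = j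
    · subst hi
      exact ⟨fun _ => h1, fun _ => hle.trans h1⟩
    · rw [heq i hi]
  have hK : bhKstar q m a' = bhKstar q m a := by
    have h := (Nat.findGreatest_eq_iff (k := m) (m := bhKstar q m a)
      (P := fun k => k ≤ ((Finset.univ : Finset (Fin m)).filter
        (fun j => a j ≤ q * k / m)).card)).1 rfl
    obtain ⟨h1, h2, h3⟩ := h
    refine Nat.findGreatest_eq_iff.2 ⟨h1, fun h0 => ?_, fun n hn hnm => ?_⟩
    · rw [key _ le_rfl]
      exact h2 h0
    · rw [key n hn.le]
      exact h3 hn hnm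
  unfold bhReject
  rw [hK]
  exact key _ le_rfl
end

section
/- In the binary classification setting with responses in {0,1}, let ŝ : 𝒳 → ℝ be a bounded function and take the nonconformity score V(x, y) = M·y − ŝ(x) with a constant M > 2·sup_{x∈𝒳}|ŝ(x)|, and thresholds c_j such that 0 < c_j < 1 for all j (so V̂_{n+j} = V(X_{n+j}, c_j) is used with the effective target Y = 1; concretely take V̂_{n+j} = −ŝ(X_{n+j})). Then for every j: (i) the full-calibration conformal p-value equals p_j = ((n⁰ + 1)/(n + 1)) · p_j^0, where n⁰ = #{i ≤ n : Y_i = 0} and p_j^0 is the same-class conformal p-value computed from the calibration points with Y_i = 0 using the same U_j; (ii) consequently p_j ≤ p_j^0, with strict inequality whenever n⁰ < n and p_j^0 > 0, and the BH rejection set at level q applied to (p_1,…,p_m) contains the BH rejection set at level q applied to (p_1^0,…,p_m^0). -/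
set_option autoImplicit false

open Finset
open scoped Classical

/-- in binary classification with the clipped score `V(x,y) = M·y − ŝ(x)`,
`M > 2·sup|ŝ|`, and test scores `V̂_{n+j} = −ŝ(X_{n+j})`: (i) the full-calibration conformal
p-value is `p_j = ((n⁰+1)/(n+1))·p_j^0` where `p_j^0` is the same-class p-value from the
calibration points with `Y_i = 0`; (ii) hence `p_j ≤ p_j^0`, strictly whenever `n⁰ < n` and
`p_j^0 > 0`, and the BH rejection set for `(p_1,…,p_m)` contains that for `(p_1^0,…,p_m^0)`. -/
theorem clipped_score_pvalue_relation
    {𝒳 : Type*} (q : ℝ) (hq0 : 0 < q) (hq1 : q < 1)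
    (n m : ℕ)
    (shat : 𝒳 → ℝ) (M : ℝ)
    (hbdd : BddAbove (Set.range fun x => |shat x|))
    (hM : 2 * sSup (Set.range fun x => |shat x|) < M)
    (Xc : Fin n → 𝒳) (Yc : Fin n → ℝ) (hYc : ∀ i, Yc i = 0 ∨ Yc i = 1)
    (Xt : Fin m → 𝒳)
    (c : Fin m → ℝ) (hc : ∀ j, 0 < c j ∧ c j < 1)
    (U : Fin m → ℝ) (hU : ∀ j, U j ∈ Set.Icc (0 : ℝ) 1)
    -- calibration scores `V_i = M·Y_i − ŝ(X_i)` and test scores `V̂_{n+j} = −ŝ(X_{n+j})`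
    (Vc : Fin n → ℝ) (hVc : ∀ i, Vc i = M * Yc i - shat (Xc i))
    (Vhat : Fin m → ℝ) (hVhat : ∀ j, Vhat j = -shat (Xt j))
    -- the number of calibration points with label 0
    (n0 : ℕ) (hn0 : n0 = (Finset.univ.filter (fun i : Fin n => Yc i = 0)).card)
    -- full-calibration conformal p-values
    (p : Fin m → ℝ)
    (hp : ∀ j, p j =
      (((Finset.univ.filter (fun i : Fin n => Vc i < Vhat j)).card : ℝ)
        + U j * (1 + ((Finset.univ.filter (fun i : Fin n => Vc i = Vhat j)).card : ℝ)))
        / (n + 1))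
    -- same-class conformal p-values, using only calibration points with `Y_i = 0`
    (p0 : Fin m → ℝ)
    (hp0 : ∀ j, p0 j =
      (((Finset.univ.filter (fun i : Fin n => Yc i = 0 ∧ Vc i < Vhat j)).card : ℝ)
        + U j * (1 + ((Finset.univ.filter
            (fun i : Fin n => Yc i = 0 ∧ Vc i = Vhat j)).card : ℝ)))
        / (n0 + 1)) :
    (∀ j, p j = ((n0 : ℝ) + 1) / ((n : ℝ) + 1) * p0 j)
      ∧ (∀ j, p j ≤ p0 j)
      ∧ (∀ j, n0 < n → 0 < p0 j → p j < p0 j)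
      ∧ bhReject q m p0 ⊆ bhReject q m p := by
  have key : ∀ i j, Yc i = 1 → Vhat j < Vc i := by
    intro i j h
    have h1 : |shat (Xc i)| ≤ sSup (Set.range fun x => |shat x|) :=
      le_csSup hbdd ⟨_, rfl⟩
    have h2 : |shat (Xt j)| ≤ sSup (Set.range fun x => |shat x|) :=
      le_csSup hbdd ⟨_, rfl⟩
    have h3 := le_abs_self (shat (Xc i))
    have h4 := neg_le_abs (shat (Xt j))
    rw [hVc, hVhat, h]
    linarith
  have zero : ∀ i j, Vc i ≤ Vhat j → Yc i = 0 := by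
    intro i j h
    rcases hYc i with h0 | h1
    · exact h0
    · exact absurd (key i j h1) (not_lt.mpr h)
  have e1 : ∀ j, (Finset.univ.filter (fun i : Fin n => Yc i = 0 ∧ Vc i < Vhat j))
      = Finset.univ.filter (fun i : Fin n => Vc i < Vhat j) := by
    intro j
    ext i
    simp only [Finset.mem_filter, Finset.mem_univ, true_and]
    exact ⟨fun h => h.2, fun h => ⟨zero i j h.le, h⟩⟩
  have e2 : ∀ j, (Finset.univ.filter (fun i : Fin n => Yc i = 0 ∧ Vc i = Vhat j))
      = Finset.univ.filter (fun i : Fin n => Vc i = Vhat j) := by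
    intro j
    ext i
    simp only [Finset.mem_filter, Finset.mem_univ, true_and]
    exact ⟨fun h => h.2, fun h => ⟨zero i j h.le, h⟩⟩
  have hn1 : (0 : ℝ) < (n : ℝ) + 1 := by positivity
  have hn01 : (0 : ℝ) < (n0 : ℝ) + 1 := by positivity
  have A : ∀ j, p j = ((n0 : ℝ) + 1) / ((n : ℝ) + 1) * p0 j := by
    intro j
    rw [hp, hp0, e1, e2]
    field_simp
  have hnn : n0 ≤ n := by
    rw [hn0]
    exact (Finset.card_le_univ _).trans (by simp)
  have pos : ∀ j, 0 ≤ p0 j := by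
    intro j
    rw [hp0]
    have := (hU j).1
    positivity
  have B : ∀ j, p j ≤ p0 j := by
    intro j
    rw [A]
    have : (n0 : ℝ) ≤ n := by exact_mod_cast hnn
    exact mul_le_of_le_one_left (pos j) ((div_le_one hn1).mpr (by linarith))
  refine ⟨A, B, ?_, ?_⟩
  · intro j hlt hpos
    rw [A]
    have : (n0 : ℝ) < n := by exact_mod_cast hlt
    exact mul_lt_of_lt_one_left hpos ((div_lt_one hn1).mpr (by linarith))
  · have hk : bhKstar q m p0 ≤ bhKstar q m p := by
      have spec : bhKstar q m p0 ≤ ((Finset.univ : Finset (Fin m)).filter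
          (fun j => p0 j ≤ q * (bhKstar q m p0 : ℕ) / m)).card :=
        Nat.findGreatest_spec (P := fun k => k ≤ ((Finset.univ : Finset (Fin m)).filter
          (fun j => p0 j ≤ q * k / m)).card) (Nat.zero_le m) (Nat.zero_le _)
      refine Nat.le_findGreatest (Nat.findGreatest_le m) (spec.trans ?_)
      apply Finset.card_le_card
      intro j hj
      simp only [Finset.mem_filter, Finset.mem_univ, true_and] at hj ⊢
      exact (B j).trans hj
    intro j hj
    simp only [bhReject, Finset.mem_filter, Finset.mem_univ, true_and] at hj ⊢
    refine (B j).trans (hj.trans ?_)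
    have : (bhKstar q m p0 : ℝ) ≤ bhKstar q m p := by exact_mod_cast hk
    gcongr
end

section
/- Fix q ∈ (0,1), m ≥ 1, and (a_1,…,a_m) ∈ [0,1]^m. Define τ̂ = sup{ t ∈ [0,1] : m·t ≤ q·#{j : a_j ≤ t} } (the set is nonempty since it contains t = 0). Then the BH rejection set at level q applied to (a_1,…,a_m) equals {j : a_j ≤ τ̂}. -/
set_option autoImplicit false

open Finset
open scoped Classical

/-- the BH rejection set coincides with the set of indices whose p-value is
below the data-dependent threshold `τ̂ = sup{t ∈ [0,1] : m·t ≤ q·#{j : a_j ≤ t}}`. -/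
theorem bh_rejection_set_eq_threshold_form
    (q : ℝ) (hq0 : 0 < q) (hq1 : q < 1) (m : ℕ) (hm : 1 ≤ m)
    (a : Fin m → ℝ) (ha : ∀ j, a j ∈ Set.Icc (0 : ℝ) 1)
    (tauHat : ℝ)
    (htau : tauHat = sSup {t : ℝ | t ∈ Set.Icc (0 : ℝ) 1 ∧
      (m : ℝ) * t ≤ q * ((Finset.univ.filter (fun j : Fin m => a j ≤ t)).card : ℝ)}) :
    bhReject q m a = Finset.univ.filter (fun j : Fin m => a j ≤ tauHat) := by
  have hm0 : (0 : ℝ) < m := by exact_mod_cast hm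
  have hk1 : bhKstar q m a ≤ m := Nat.findGreatest_le m
  have hk2 : bhKstar q m a ≤ ((Finset.univ : Finset (Fin m)).filter
      (fun j => a j ≤ q * (bhKstar q m a : ℕ) / m)).card := by
    have h := Nat.findGreatest_spec (P := fun k : ℕ => k ≤ ((Finset.univ : Finset (Fin m)).filter
      (fun j => a j ≤ q * k / m)).card) (Nat.zero_le m) (Nat.zero_le _)
    exact h
  have hk3 : ∀ K : ℕ, K ≤ m → K ≤ ((Finset.univ : Finset (Fin m)).filter
      (fun j => a j ≤ q * K / m)).card → K ≤ bhKstar q m a := by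
    intro K hK h
    exact Nat.le_findGreatest hK h
  have key : tauHat = q * (bhKstar q m a) / m := by
    rw [htau]
    apply IsGreatest.csSup_eq
    have hk1' : (bhKstar q m a : ℝ) ≤ m := by exact_mod_cast hk1
    have hk2' : (bhKstar q m a : ℝ) ≤ (((Finset.univ : Finset (Fin m)).filter
      (fun j => a j ≤ q * (bhKstar q m a : ℕ) / m)).card : ℝ) := by exact_mod_cast hk2
    refine ⟨⟨⟨by positivity, ?_⟩, ?_⟩, ?_⟩
    · rw [div_le_one hm0]
      have : (0 : ℝ) ≤ (bhKstar q m a : ℝ) := Nat.cast_nonneg _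
      nlinarith
    · rw [mul_div_cancel₀ _ hm0.ne']
      exact mul_le_mul_of_nonneg_left hk2' hq0.le
    · rintro t ⟨_, ht⟩
      set K := (Finset.univ.filter (fun j : Fin m => a j ≤ t)).card with hKdef
      have htK : t ≤ q * K / m := by
        rw [le_div_iff₀ hm0]; linarith
      have hKm : K ≤ m := by
        simpa using Finset.card_le_univ (Finset.univ.filter (fun j : Fin m => a j ≤ t))
      have hKk : K ≤ bhKstar q m a := by
        apply hk3 K hKm
        conv_lhs => rw [hKdef]
        apply Finset.card_le_card
        intro j hj
        simp only [Finset.mem_filter, Finset.mem_univ, true_and] at hj ⊢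
        exact hj.trans htK
      have hKk' : (K : ℝ) ≤ bhKstar q m a := by exact_mod_cast hKk
      refine htK.trans ?_
      gcongr
  unfold bhReject
  rw [key]
end
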